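/- For all integers M ≥ 2 and 1 ≤ m ≤ M−1, the partial sums of the sequence (u_n) satisfy Σ_{i=M−1−m}^{M−2} u_i = (m·λ^m − (2M−m)·λ^M + (2M−m)·λ^{M+m} − m·λ^{2M}) / (p·(1−λ)·(λ^m − λ^M)·(1 − λ^M)). -/

import Mathlib

/-- Explicit solution of the recurrence defining `u`. -/
theorem u_closed_form {p lam : ℝ} (hp : p ≠ 0) (hlam0 : 0 < lam) (hlam1 : lam < 1)
    (hplam : p * (1 + lam) = 1) {u : ℕ → ℝ} (hu0 : u 0 = 1)
    (hu : ∀ n : ℕ, 1 ≤ n →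
      u n = lam * ((1 - lam ^ n) / (1 - lam ^ (n + 2))) * u (n - 1) +
        (1 / p) * ((1 - lam ^ (n + 1)) / (1 - lam ^ (n + 2)))) (n : ℕ) :
    u n = ((1 - lam ^ (n + 1)) * (1 + lam ^ (n + 2))
        - 2 * ((n : ℝ) + 1) * (1 - lam) * lam ^ (n + 1)) /
      (p * (1 - lam) * (1 - lam ^ (n + 1)) * (1 - lam ^ (n + 2))) := by
  have hne (k : ℕ) : 1 - lam ^ (k + 1) ≠ 0 :=
    (sub_pos.2 (pow_lt_one₀ hlam0.le hlam1 k.succ_ne_zero)).ne'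
  have h1 : 1 - lam ≠ 0 := (sub_pos.2 hlam1).ne'
  induction n with
  | zero =>
    have h2 := hne 1
    rw [hu0, eq_div_iff (by simp_all)]
    push_cast
    linear_combination (1 - lam) ^ 3 * hplam
  | succ n ih =>
    have h2 := hne n
    have h3 := hne (n + 1)
    have h4 := hne (n + 2)
    rw [hu (n + 1) (by omega), Nat.add_sub_cancel, ih]
    push_cast
    simp only [add_assoc, Nat.reduceAdd, pow_add, pow_one, mul_comm (lam ^ n)] at h2 h3 h4 ⊢
    generalize lam ^ n = L at *
    field_simp
    ring

/-- Partial sums of `u` over `m` consecutive indices starting at `a`. -/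
theorem sum_range_u_closed_form {p lam : ℝ} (hp : p ≠ 0) (hlam0 : 0 < lam) (hlam1 : lam < 1)
    (hplam : p * (1 + lam) = 1) {u : ℕ → ℝ} (hu0 : u 0 = 1)
    (hu : ∀ n : ℕ, 1 ≤ n →
      u n = lam * ((1 - lam ^ n) / (1 - lam ^ (n + 2))) * u (n - 1) +
        (1 / p) * ((1 - lam ^ (n + 1)) / (1 - lam ^ (n + 2)))) (a m : ℕ) :
    ∑ i ∈ Finset.range m, u (a + i) =
      ((m : ℝ) - (2 * a + 2 + m) * lam ^ (a + 1) + (2 * a + 2 + m) * lam ^ (a + m + 1)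
          - m * (lam ^ (a + 1) * lam ^ (a + m + 1))) /
        (p * (1 - lam) * (1 - lam ^ (a + 1)) * (1 - lam ^ (a + m + 1))) := by
  have hne (k : ℕ) : 1 - lam ^ (k + 1) ≠ 0 :=
    (sub_pos.2 (pow_lt_one₀ hlam0.le hlam1 k.succ_ne_zero)).ne'
  have h1 : 1 - lam ≠ 0 := (sub_pos.2 hlam1).ne'
  induction m with
  | zero => simp
  | succ m ih =>
    have h2 := hne a
    have h3 := hne (a + m)
    have h4 := hne (a + m + 1)
    rw [Finset.sum_range_succ, ih, u_closed_form hp hlam0 hlam1 hplam hu0 hu]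
    push_cast
    rw [show a + (m + 1) + 1 = a + m + 2 by ring]
    have h5 : lam ^ (a + m + 2) = lam ^ (a + m + 1) * lam := by ring
    rw [show a + m + 1 + 1 = a + m + 2 by ring, h5] at h4
    rw [h5]
    generalize lam ^ (a + m + 1) = L at *
    generalize lam ^ (a + 1) = A at *
    field_simp
    ring


/-- Closed form for the partial sums of the auxiliary sequence `u`. -/
theorem u_partial_sum_closed_form
    (q p lam : ℝ) (hq0 : 0 < q) (hq : q < 1 / 2) (hp : p = 1 - q) (hlam : lam = q / p)
    (u : ℕ → ℝ) (hu0 : u 0 = 1)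
    (hu : ∀ n : ℕ, 1 ≤ n →
      u n = lam * ((1 - lam ^ n) / (1 - lam ^ (n + 2))) * u (n - 1) +
        (1 / p) * ((1 - lam ^ (n + 1)) / (1 - lam ^ (n + 2)))) :
    ∀ M m : ℕ, 2 ≤ M → 1 ≤ m → m ≤ M - 1 →
      ∑ i ∈ Finset.Icc (M - 1 - m) (M - 2), u i =
        ((m : ℝ) * lam ^ m - (2 * (M : ℝ) - m) * lam ^ M
            + (2 * (M : ℝ) - m) * lam ^ (M + m) - (m : ℝ) * lam ^ (2 * M)) /
          (p * (1 - lam) * (lam ^ m - lam ^ M) * (1 - lam ^ M)) := by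
  intro M m hM hm hmM
  have hp0 : 0 < p := by linarith
  have hlam0 : 0 < lam := hlam ▸ div_pos hq0 hp0
  have hlam1 : lam < 1 := by rw [hlam, div_lt_one hp0]; linarith
  have hplam : p * (1 + lam) = 1 := by
    rw [hlam, mul_add, mul_div_cancel₀ _ hp0.ne']; linarith
  obtain ⟨a, rfl⟩ : ∃ a, M = a + m + 1 := ⟨M - 1 - m, by omega⟩
  have hIcc : Finset.Icc (a + m + 1 - 1 - m) (a + m + 1 - 2) = Finset.Ico a (a + m) := by
    ext i
    simp only [Finset.mem_Icc, Finset.mem_Ico]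
    omega
  rw [hIcc, Finset.sum_Ico_eq_sum_range, Nat.add_sub_cancel_left,
    sum_range_u_closed_form hp0.ne' hlam0 hlam1 hplam hu0 hu,
    ← mul_div_mul_left _ _ (pow_pos hlam0 m).ne']
  push_cast
  congr 1 <;> ring
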